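/- Let f1, f2, f3 be integers and k, ℓ, s, p nonnegative integers with f2−f3 ≥ 2, k ≤ f1−f2, p ≤ f1−f2, p+ℓ ≥ s, ℓ+k ≥ s, and f1−f2−k−p+s ≥ 0. Define 2U = f1−f2−k+ℓ, 2T = f2−f3+p+s−2, 2j1 = f1−f3−p+s−2, 2j2 = f2−f3+p−s+ℓ+k−2, 2j3 = ℓ+k, 2j = f1−f2. Then the following symmetry between two explicit q-Racah coefficients of su_q(2) holds: (−1)^s · sqrt( [2U+1][2T+1] / ([2j2+1][2j+1]) ) · U_q(T j3 j1 U; j2 j) = (−1)^k · U_q(j1 j2 j j3; U T). -/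

import Mathlib

noncomputable def qnum (q : ℝ) (n : ℤ) : ℝ := (q ^ n - q ^ (-n)) / (q - q⁻¹)

noncomputable def qfact (q : ℝ) : ℕ → ℝ
  | 0 => 1
  | n + 1 => qnum q ((n : ℤ) + 1) * qfact q n

/-- q-factorial of an integer argument. -/
noncomputable def qfactZ (q : ℝ) (n : ℤ) : ℝ := qfact q n.toNat

/-- q-number of a rational argument (used only at integer-valued rationals). -/
noncomputable def qnumQ (q : ℝ) (x : ℚ) : ℝ := qnum q ⌊x⌋

/-- q-factorial of a rational argument (used only at nonnegative integer-valued
rationals). -/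
noncomputable def qfactQ (q : ℝ) (x : ℚ) : ℝ := qfact q (⌊x⌋).toNat

/-- The explicit q-Racah coefficient `U_q(a b e d; c f)` of `su_q(2)` (formula (5.31) of
Asherova–Smirnov–Tolstoy), the sum running over all integers `n ≥ 0` for which every
q-factorial argument is nonnegative. -/
noncomputable def URacah (q : ℝ) (a b e d c f : ℚ) : ℝ :=
  (-1 : ℝ) ^ ⌊a + d - c - f⌋ *
    Real.sqrt (qnumQ q (2 * c + 1) * qnumQ q (2 * f + 1) * qfactQ q (a + b + c + 1) *
      qfactQ q (b + d + f + 1) * qfactQ q (a - b + c) * qfactQ q (-a + b + c) *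
      qfactQ q (a + e - f) * qfactQ q (b - d + f) * qfactQ q (-b + d + f) *
      qfactQ q (-c + d + e) /
      (qfactQ q (a + e + f + 1) * qfactQ q (c + d + e + 1) * qfactQ q (a + b - c) *
        qfactQ q (a - e + f) * qfactQ q (b + d - f) * qfactQ q (c + d - e) *
        qfactQ q (c - d + e) * qfactQ q (-a + e + f))) *
    ∑ n ∈ Finset.range ((⌊2 * b⌋).toNat + 1),
      if 0 ≤ 2 * b - n ∧ 0 ≤ b + c - e + f - n ∧ 0 ≤ b + c + e + f + 1 - n ∧
          0 ≤ -a + b + c - n ∧ 0 ≤ b - d + f - n ∧ 0 ≤ a + b + c + 1 - n ∧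
          0 ≤ b + d + f + 1 - n then
        (-1 : ℝ) ^ n * qfactQ q (2 * b - n) * qfactQ q (b + c - e + f - n) *
          qfactQ q (b + c + e + f + 1 - n) /
          (qfact q n * qfactQ q (-a + b + c - n) * qfactQ q (b - d + f - n) *
            qfactQ q (a + b + c + 1 - n) * qfactQ q (b + d + f + 1 - n))
      else 0

/-- The q-Weyl coefficient `⟨U|T⟩_q` (formula (113)) for the positive discrete series of
`u_q(2,1)` with lowest weight `(f1,f2,f3)`, expressed through the labels `k, ℓ, s, p` via
`2U = f1−f2−k+ℓ`, `2T = f2−f3+p+s−2`, `U−M_U = p−s+ℓ`, `U+M_U = f1−f2−k−p+s`,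
`T+M = f2−f3+p+ℓ+k−1`. -/
noncomputable def qWeyl (q : ℝ) (f1 f2 f3 : ℤ) (k l s p : ℕ) : ℝ :=
  Real.sqrt (qnum q (f1 - f2 - (k : ℤ) + (l : ℤ) + 1) *
      qnum q (f2 - f3 + (p : ℤ) + (s : ℤ) - 1) * qfact q k *
      qfactZ q ((l : ℤ) + (k : ℤ) - (s : ℤ)) *
      qfactZ q (f1 - f2 - (k : ℤ) - (p : ℤ) + (s : ℤ)) *
      qfactZ q (f2 - f3 + (p : ℤ) + (l : ℤ) + (k : ℤ) - 1) *
      qfactZ q (f1 - f2 - (k : ℤ)) * qfactZ q (f1 - f2 + (l : ℤ) + 1) *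
      qfactZ q (f2 - f3 + (s : ℤ) - 2) * qfactZ q (f2 - f3 + (p : ℤ) - 2) /
      (qfact q s * qfact q p * qfact q l * qfactZ q ((p : ℤ) - (s : ℤ) + (l : ℤ)) *
        qfactZ q (f1 - f3 + (s : ℤ) - 1) * qfactZ q (f1 - f2 - (p : ℤ)) *
        qfactZ q (f2 - f3 + (k : ℤ) - 2) * qfactZ q (f1 - f3 + (l : ℤ) - 1))) *
    ∑ n ∈ Finset.range (min k (l + k - s) + 1),
      (-1 : ℝ) ^ (k + n) *
        qfactZ q ((p : ℤ) - (s : ℤ) + (l : ℤ) + (k : ℤ) - (n : ℤ)) *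
        qfactZ q ((l : ℤ) + (k : ℤ) - (n : ℤ)) *
        qfactZ q (f1 - f3 + (l : ℤ) + (k : ℤ) - (n : ℤ) - 1) /
        (qfact q n * qfact q (k - n) * qfactZ q (f1 - f2 + (l : ℤ) + 1 - (n : ℤ)) *
          qfactZ q ((l : ℤ) + (k : ℤ) - (s : ℤ) - (n : ℤ)) *
          qfactZ q (f2 - f3 + (p : ℤ) + (l : ℤ) + (k : ℤ) - (n : ℤ) - 1))

lemma qnum_zero (q : ℝ) : qnum q 0 = 0 := by simp [qnum]

lemma qnum_neg (q : ℝ) (n : ℤ) : qnum q (-n) = -qnum q n := by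
  simp only [qnum, neg_neg]; ring

lemma qnum_pos {q : ℝ} (hq : 0 < q) (hq1 : q ≠ 1) {n : ℤ} (hn : 0 < n) : 0 < qnum q n := by
  rcases lt_or_gt_of_ne hq1 with h | h
  · have h1 : q ^ n < q ^ (-n) := zpow_lt_zpow_right_of_lt_one₀ hq h (by omega)
    have h2 : q < q⁻¹ := h.trans ((one_lt_inv₀ hq).2 h)
    exact div_pos_of_neg_of_neg (by linarith) (by linarith)
  · have h1 : q ^ (-n) < q ^ n := zpow_lt_zpow_right₀ h (by omega)
    have h2 : q⁻¹ < q := (inv_lt_one_of_one_lt₀ h).trans h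
    exact div_pos (by linarith) (by linarith)

lemma qnum_mul_sub_mul {q : ℝ} (hq : 0 < q) (x y z w : ℤ) (h : x + y = z + w) :
    qnum q x * qnum q y - qnum q z * qnum q w = qnum q (x - z) * qnum q (y - z) := by
  obtain rfl : w = x + y - z := by omega
  have hq0 := hq.ne'
  simp only [qnum, neg_sub, zpow_sub₀ hq0, zpow_add₀ hq0, zpow_neg]
  have hx := zpow_ne_zero x hq0
  have hy := zpow_ne_zero y hq0
  have hz := zpow_ne_zero z hq0
  field_simp
  ring

/-- The three-term linear relation between `[x-n]`, `[y-n]` and `[z-n]`. -/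
lemma qnum_three_term {q : ℝ} (hq : 0 < q) (x y z n : ℤ) :
    qnum q (x - n) * qnum q (z - y) =
      qnum q (y - n) * qnum q (z - x) + qnum q (z - n) * qnum q (x - y) := by
  have := qnum_mul_sub_mul hq (x - n) (z - y) (z - n) (x - y) (by ring)
  rw [show x - n - (z - n) = -(z - x) by ring, show z - y - (z - n) = -(y - n) by ring,
    qnum_neg, qnum_neg] at this
  linarith

lemma qfactZ_pos {q : ℝ} (hq : 0 < q) (hq1 : q ≠ 1) (n : ℤ) : 0 < qfactZ q n := by
  unfold qfactZ
  induction n.toNat with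
  | zero => simp [qfact]
  | succ m ih => exact mul_pos (qnum_pos hq hq1 (by omega)) ih

lemma qfactZ_eq_mul (q : ℝ) {n : ℤ} (hn : 1 ≤ n) :
    qfactZ q n = qnum q n * qfactZ q (n - 1) := by
  obtain ⟨m, rfl⟩ : ∃ m : ℕ, n = m + 1 := ⟨(n - 1).toNat, by omega⟩
  have h1 : ((m : ℤ) + 1).toNat = m + 1 := by omega
  have h2 : ((m : ℤ) + 1 - 1).toNat = m := by omega
  simp only [qfactZ, h1, h2, qfact]

/-- The reciprocal of the `q`-factorial, extended by zero to negative integers. -/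
noncomputable def qfactInv (q : ℝ) (n : ℤ) : ℝ := if n < 0 then 0 else (qfactZ q n)⁻¹

lemma qfactInv_of_neg (q : ℝ) {n : ℤ} (hn : n < 0) : qfactInv q n = 0 := if_pos hn

lemma qfactInv_of_nonneg (q : ℝ) {n : ℤ} (hn : 0 ≤ n) : qfactInv q n = (qfactZ q n)⁻¹ :=
  if_neg (by omega)

lemma qfactInv_sub_one {q : ℝ} (hq : 0 < q) (hq1 : q ≠ 1) (n : ℤ) :
    qfactInv q (n - 1) = qnum q n * qfactInv q n := by
  rcases lt_trichotomy n 0 with h | rfl | h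
  · rw [qfactInv_of_neg q h, qfactInv_of_neg q (by omega), mul_zero]
  · rw [qfactInv_of_neg q (by omega), qnum_zero, zero_mul]
  · rw [qfactInv_of_nonneg q h.le, qfactInv_of_nonneg q (by omega),
      qfactZ_eq_mul q (n := n) (by omega)]
    have := (qnum_pos hq hq1 h).ne'
    have := (qfactZ_pos hq hq1 (n - 1)).ne'
    field_simp

lemma sum_range_eq_neg_sum_of_shift (K : ℕ) (g t : ℕ → ℝ) (h0 : g 0 = 0)
    (hs : ∀ n, g (n + 1) = -t n) (hK : ∀ n, n + 1 = K → t n = 0) :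
    ∑ n ∈ Finset.range K, g n = -∑ n ∈ Finset.range K, t n := by
  cases K with
  | zero => simp
  | succ K =>
    rw [Finset.sum_range_succ', Finset.sum_range_succ, hK K rfl, h0]
    simp [hs]

/-- The `q`-Pfaff–Saalschütz sum, written with `q`-factorials. -/
lemma q_saalschutz {q : ℝ} (hq : 0 < q) (hq1 : q ≠ 1) (r : ℕ) :
    ∀ (A B C D : ℤ) (K : ℕ), A + B + 1 = r + C + D → r ≤ A → r ≤ B → r < K →
    ∑ n ∈ Finset.range K, (-1 : ℝ) ^ n * qfactZ q (A - n) * qfactZ q (B - n) *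
        qfactInv q n * qfactInv q (r - n) * qfactInv q (C - n) * qfactInv q (D - n) =
      (-1) ^ r * qfactZ q (A - r) * qfactZ q (B - r) * qfactInv q r * qfactInv q C *
        qfactInv q D * (∏ i ∈ Finset.range r, qnum q (C - A + i)) *
        ∏ i ∈ Finset.range r, qnum q (D - A + i) := by
  induction r with
  | zero =>
    intro A B C D K _ _ _ hK
    rw [Finset.sum_eq_single 0]
    · simp [qfactInv, qfactZ, qfact]
    · intro n _ hn
      rw [qfactInv_of_neg q (n := ((0 : ℕ) : ℤ) - n) (by omega)]
      ring
    · intro h; simp at h; omega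
  | succ r ih =>
    intro A B C D K h hA hB hK
    push_cast at h hA hB
    have e1 := ih A B (C + 1) D K (by linarith) (by omega) (by omega) (by omega)
    have e2 := ih (A - 1) (B - 1) C (D - 1) K (by linarith) (by omega) (by omega) (by omega)
    have shift := sum_range_eq_neg_sum_of_shift K
      (fun n => (-1 : ℝ) ^ n * qfactZ q (A - n) * qfactZ q (B - n) *
        qfactInv q ((n : ℤ) - 1) * qfactInv q (r + 1 - n) * qfactInv q (C + 1 - n) *
        qfactInv q (D - n))
      (fun n => (-1 : ℝ) ^ n * qfactZ q (A - 1 - n) * qfactZ q (B - 1 - n) *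
        qfactInv q n * qfactInv q (r - n) * qfactInv q (C - n) * qfactInv q (D - 1 - n))
      (by simp [qfactInv]) (fun n => by
        push_cast
        rw [show A - ((n : ℤ) + 1) = A - 1 - n by ring, show B - ((n : ℤ) + 1) = B - 1 - n by ring,
          show (n : ℤ) + 1 - 1 = n by ring, show (r : ℤ) + 1 - (n + 1) = r - n by ring,
          show C + 1 - ((n : ℤ) + 1) = C - n by ring, show D - ((n : ℤ) + 1) = D - 1 - n by ring]
        ring)
      (fun n hn => by
        rw [qfactInv_of_neg q (n := (r : ℤ) - n) (by omega)]
        ring)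
    rw [e2] at shift
    have hr : qnum q (r + 1) ≠ 0 := (qnum_pos hq hq1 (by omega)).ne'
    have rel : qnum q (r + 1) * ∑ n ∈ Finset.range K, (-1 : ℝ) ^ n * qfactZ q (A - n) *
        qfactZ q (B - n) * qfactInv q n * qfactInv q (((r + 1 : ℕ) : ℤ) - n) *
        qfactInv q (C - n) * qfactInv q (D - n) =
        qnum q (C + 1) * ∑ n ∈ Finset.range K, (-1 : ℝ) ^ n * qfactZ q (A - n) *
        qfactZ q (B - n) * qfactInv q n * qfactInv q (r - n) * qfactInv q (C + 1 - n) *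
        qfactInv q (D - n) + qnum q (C - r) * ∑ n ∈ Finset.range K,
        (-1 : ℝ) ^ n * qfactZ q (A - n) * qfactZ q (B - n) *
        qfactInv q ((n : ℤ) - 1) * qfactInv q (r + 1 - n) * qfactInv q (C + 1 - n) *
        qfactInv q (D - n) := by
      simp only [Finset.mul_sum, ← Finset.sum_add_distrib]
      refine Finset.sum_congr rfl fun n _ => ?_
      push_cast
      have h1 := qfactInv_sub_one hq hq1 n
      have h2 := qfactInv_sub_one hq hq1 (r + 1 - n)
      have h3 := qfactInv_sub_one hq hq1 (C + 1 - n)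
      have h4 := qnum_three_term hq (C + 1) (r + 1) 0 n
      rw [show (r : ℤ) + 1 - n - 1 = r - n by ring] at h2
      rw [show C + 1 - (n : ℤ) - 1 = C - n by ring] at h3
      rw [zero_sub, zero_sub, zero_sub, show C + 1 - ((r : ℤ) + 1) = C - r by ring,
        qnum_neg, qnum_neg, qnum_neg] at h4
      rw [h1, h2, h3]
      linear_combination (-((-1 : ℝ) ^ n * qfactZ q (A - n) * qfactZ q (B - n) *
        qfactInv q n * qfactInv q (r + 1 - n) * qfactInv q (C + 1 - n) * qfactInv q (D - n))) * h4
    rw [e1, shift] at rel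
    refine mul_left_cancel₀ hr (rel.trans ?_)
    have a1 := qfactInv_sub_one hq hq1 (C + 1)
    have a2 := qfactInv_sub_one hq hq1 D
    have a3 := qfactInv_sub_one hq hq1 ((r : ℤ) + 1)
    have a4 := qfactZ_eq_mul q (n := A - r) (by omega)
    have a5 := qfactZ_eq_mul q (n := B - r) (by omega)
    have a6 := qnum_mul_sub_mul hq (A - r) (B - r) (C - r) D (by linarith)
    rw [add_sub_cancel_right] at a1 a3
    rw [Finset.prod_range_succ', Finset.prod_range_succ _ r, pow_succ]
    push_cast
    simp only [add_zero]
    rw [show A - 1 - (r : ℤ) = A - r - 1 by ring, show B - 1 - (r : ℤ) = B - r - 1 by ring,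
      show A - ((r : ℤ) + 1) = A - r - 1 by ring, show B - ((r : ℤ) + 1) = B - r - 1 by ring,
      a4, a5, a2, a3]
    rw [show A - (r : ℤ) - (C - r) = -(C - A) by ring, qnum_neg,
      show B - (r : ℤ) - (C - r) = D - A + r by linarith] at a6
    have p1 : ∏ i ∈ Finset.range r, qnum q (C + 1 - A + i) =
        ∏ i ∈ Finset.range r, qnum q (C - A + (i + 1)) :=
      Finset.prod_congr rfl fun i _ => by congr 1; ring
    have p2 : ∏ i ∈ Finset.range r, qnum q (C - (A - 1) + i) =
        ∏ i ∈ Finset.range r, qnum q (C - A + (i + 1)) :=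
      Finset.prod_congr rfl fun i _ => by congr 1; ring
    have p3 : ∏ i ∈ Finset.range r, qnum q (D - 1 - (A - 1) + i) =
        ∏ i ∈ Finset.range r, qnum q (D - A + i) :=
      Finset.prod_congr rfl fun i _ => by congr 1; ring
    rw [p1, p2, p3, a1]
    set P := ∏ i ∈ Finset.range r, qnum q (C - A + (i + 1))
    set Q := ∏ i ∈ Finset.range r, qnum q (D - A + i)
    linear_combination ((-1) ^ r * qfactZ q (A - r - 1) * qfactZ q (B - r - 1) * qnum q (r + 1) *
      qfactInv q (r + 1) * qnum q (C + 1) * qfactInv q (C + 1) * qfactInv q D * P * Q) * a6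

/-- The balanced alternating sum occurring in the `q`-Racah coefficient. -/
noncomputable def qRacahSum (q : ℝ) (K : ℕ) (t₁ t₂ t₃ b₁ b₂ b₃ b₄ : ℤ) : ℝ :=
  ∑ n ∈ Finset.range K, (-1 : ℝ) ^ n * qfactZ q (t₁ - n) * qfactZ q (t₂ - n) *
    qfactZ q (t₃ - n) * qfactInv q n * qfactInv q (b₁ - n) * qfactInv q (b₂ - n) *
    qfactInv q (b₃ - n) * qfactInv q (b₄ - n)

lemma qRacahSum_contiguous {q : ℝ} (hq : 0 < q) (hq1 : q ≠ 1) (K : ℕ)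
    (t₁ t₂ t₃ b₁ b₂ b₃ b₄ : ℤ) (h : b₁ ≤ t₂) :
    qnum q (b₃ - b₂) * qRacahSum q K t₁ (t₂ + 1) t₃ b₁ b₂ b₃ b₄ =
      qnum q (b₃ - (t₂ + 1)) * qRacahSum q K t₁ t₂ t₃ b₁ (b₂ - 1) b₃ b₄ +
      qnum q (t₂ + 1 - b₂) * qRacahSum q K t₁ t₂ t₃ b₁ b₂ (b₃ - 1) b₄ := by
  simp only [qRacahSum, Finset.mul_sum, ← Finset.sum_add_distrib]
  refine Finset.sum_congr rfl fun n _ => ?_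
  rcases lt_or_ge (b₁ - n) 0 with hn | hn
  · rw [qfactInv_of_neg q hn]; ring
  have h1 := qfactInv_sub_one hq hq1 (b₂ - n)
  have h2 := qfactInv_sub_one hq hq1 (b₃ - n)
  have h3 := qfactZ_eq_mul q (n := t₂ + 1 - n) (by omega)
  have h4 := qnum_three_term hq (t₂ + 1) b₂ b₃ n
  rw [show b₂ - 1 - (n : ℤ) = b₂ - n - 1 by ring, show b₃ - 1 - (n : ℤ) = b₃ - n - 1 by ring,
    h1, h2, h3, show t₂ + 1 - (n : ℤ) - 1 = t₂ - n by ring]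
  linear_combination ((-1 : ℝ) ^ n * qfactZ q (t₁ - n) * qfactZ q (t₂ - n) *
    qfactZ q (t₃ - n) * qfactInv q n * qfactInv q (b₁ - n) * qfactInv q (b₂ - n) *
    qfactInv q (b₃ - n) * qfactInv q (b₄ - n)) * h4

lemma qRacahSum_contiguous_shift {q : ℝ} (hq : 0 < q) (hq1 : q ≠ 1) (K : ℕ)
    (t₁ t₂ t₃ b₁ b₂ b₃ b₄ : ℤ) (h : b₂ ≤ t₂) (hK : b₁ < K) :
    qnum q (t₂ + 1) * qRacahSum q K t₁ t₂ t₃ b₁ b₂ b₃ b₄ =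
      qnum q (b₃ + 1) * qRacahSum q K t₁ (t₂ + 1) t₃ b₁ b₂ (b₃ + 1) b₄ -
      qnum q (b₃ - t₂) *
        qRacahSum q K (t₁ - 1) (t₂ - 1) (t₃ - 1) (b₁ - 1) (b₂ - 1) b₃ (b₄ - 1) := by
  have shift := sum_range_eq_neg_sum_of_shift K
    (fun n => (-1 : ℝ) ^ n * qfactZ q (t₁ - n) * qfactZ q (t₂ - n) * qfactZ q (t₃ - n) *
      qfactInv q ((n : ℤ) - 1) * qfactInv q (b₁ - n) * qfactInv q (b₂ - n) *
      qfactInv q (b₃ + 1 - n) * qfactInv q (b₄ - n))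
    (fun n => (-1 : ℝ) ^ n * qfactZ q (t₁ - 1 - n) * qfactZ q (t₂ - 1 - n) *
      qfactZ q (t₃ - 1 - n) * qfactInv q n * qfactInv q (b₁ - 1 - n) * qfactInv q (b₂ - 1 - n) *
      qfactInv q (b₃ - n) * qfactInv q (b₄ - 1 - n))
    (by simp [qfactInv]) (fun n => by
      push_cast
      rw [show t₁ - ((n : ℤ) + 1) = t₁ - 1 - n by ring,
        show t₂ - ((n : ℤ) + 1) = t₂ - 1 - n by ring, show t₃ - ((n : ℤ) + 1) = t₃ - 1 - n by ring,
        show (n : ℤ) + 1 - 1 = n by ring, show b₁ - ((n : ℤ) + 1) = b₁ - 1 - n by ring,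
        show b₂ - ((n : ℤ) + 1) = b₂ - 1 - n by ring,
        show b₃ + 1 - ((n : ℤ) + 1) = b₃ - n by ring, show b₄ - ((n : ℤ) + 1) = b₄ - 1 - n by ring]
      ring)
    (fun n hn => by
      rw [qfactInv_of_neg q (n := b₁ - 1 - n) (by omega)]
      ring)
  rw [sub_eq_add_neg, ← mul_neg]
  simp only [qRacahSum]
  rw [← shift]
  simp only [Finset.mul_sum, ← Finset.sum_add_distrib]
  refine Finset.sum_congr rfl fun n _ => ?_
  rcases lt_or_ge (b₂ - n) 0 with hn | hn
  · rw [qfactInv_of_neg q hn]; ring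
  have h1 := qfactInv_sub_one hq hq1 n
  have h2 := qfactInv_sub_one hq hq1 (b₃ + 1 - n)
  have h3 := qfactZ_eq_mul q (n := t₂ + 1 - n) (by omega)
  have h4 := qnum_three_term hq (b₃ + 1) (t₂ + 1) 0 n
  rw [zero_sub, zero_sub, zero_sub, show b₃ + 1 - (t₂ + 1) = b₃ - t₂ by ring,
    qnum_neg, qnum_neg, qnum_neg] at h4
  rw [show b₃ + 1 - (n : ℤ) - 1 = b₃ - n by ring] at h2
  rw [show t₂ + 1 - (n : ℤ) - 1 = t₂ - n by ring] at h3
  rw [h1, h2, h3]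
  linear_combination (-((-1 : ℝ) ^ n * qfactZ q (t₁ - n) * qfactZ q (t₂ - n) *
    qfactZ q (t₃ - n) * qfactInv q n * qfactInv q (b₁ - n) * qfactInv q (b₂ - n) *
    qfactInv q (b₃ + 1 - n) * qfactInv q (b₄ - n))) * h4

/-- When `t₂ = b₄`, the sum `qRacahSum` is of Saalschütz type. -/
lemma qRacahSum_cancel {q : ℝ} (hq : 0 < q) (hq1 : q ≠ 1) (K : ℕ)
    (t₁ t₂ t₃ b₁ b₂ b₃ : ℤ) (h : b₁ ≤ t₂) :
    qRacahSum q K t₁ t₂ t₃ b₁ b₂ b₃ t₂ =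
      ∑ n ∈ Finset.range K, (-1 : ℝ) ^ n * qfactZ q (t₁ - n) * qfactZ q (t₃ - n) *
        qfactInv q n * qfactInv q (b₁ - n) * qfactInv q (b₂ - n) * qfactInv q (b₃ - n) := by
  refine Finset.sum_congr rfl fun n _ => ?_
  rcases lt_or_ge (b₁ - n) 0 with hn | hn
  · rw [qfactInv_of_neg q hn]; ring
  have := (qfactZ_pos hq hq1 (t₂ - n)).ne'
  rw [qfactInv_of_nonneg q (n := t₂ - n) (by omega)]
  field_simp

lemma qRacahSum_rotate (q : ℝ) (K : ℕ) (t₁ t₂ t₃ b₁ b₂ b₃ b₄ : ℤ) :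
    qRacahSum q K t₁ t₂ t₃ b₁ b₂ b₃ b₄ = qRacahSum q K t₁ t₂ t₃ b₂ b₃ b₄ b₁ :=
  Finset.sum_congr rfl fun _ _ => by ring

lemma qRacahSum_swap (q : ℝ) (K : ℕ) (t₁ t₂ t₃ b₁ b₂ b₃ b₄ : ℤ) :
    qRacahSum q K t₁ t₂ t₃ b₁ b₂ b₃ b₄ = qRacahSum q K t₁ t₃ t₂ b₁ b₂ b₄ b₃ :=
  Finset.sum_congr rfl fun _ _ => by ring

lemma qfactZ_mul_prod_add (q : ℝ) (c : ℤ) (hc : 0 ≤ c) (r : ℕ) :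
    qfactZ q c * ∏ i ∈ Finset.range r, qnum q (c + 1 + i) = qfactZ q (c + r) := by
  induction r with
  | zero => simp
  | succ r ih =>
    rw [Finset.prod_range_succ, ← mul_assoc, ih, qfactZ_eq_mul q (n := c + (r + 1 : ℕ)) (by omega)]
    push_cast
    rw [show c + 1 + (r : ℤ) = c + (r + 1) by ring, show c + ((r : ℤ) + 1) - 1 = c + r by ring]
    ring

lemma qfactZ_mul_prod_neg (q : ℝ) (c : ℤ) (hc : 0 ≤ c) (r : ℕ) :
    qfactZ q c * ∏ i ∈ Finset.range r, qnum q (-(c + r) + i) = (-1) ^ r * qfactZ q (c + r) := by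
  induction r with
  | zero => simp
  | succ r ih =>
    have e : ∏ i ∈ Finset.range r, qnum q (-(c + (r + 1 : ℕ)) + (i + 1 : ℕ)) =
        ∏ i ∈ Finset.range r, qnum q (-(c + r) + i) :=
      Finset.prod_congr rfl fun i _ => by congr 1; push_cast; ring
    rw [Finset.prod_range_succ', e, ← mul_assoc, ih,
      qfactZ_eq_mul q (n := c + (r + 1 : ℕ)) (by omega)]
    push_cast
    rw [add_zero, qnum_neg, show c + ((r : ℤ) + 1) - 1 = c + r by ring]
    ring

lemma qRacahSum_symm_zero {q : ℝ} (hq : 0 < q) (hq1 : q ≠ 1) (M N s : ℤ) (k r K K' : ℕ)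
    (hM : 0 ≤ M) (hkN : k ≤ N) (hs : 0 ≤ s) (hK : k < K) (hK' : r < K') :
    (-1 : ℝ) ^ k * (qfactZ q (N + (s + r) + 1) * qfactZ q (r + k) * qfactZ q (M + s) *
        qfactZ q (N - k)) *
      qRacahSum q K (s + r + k) (r + k) (s + r + k + M + N + 1) (r + k) k
        (M + (s + r) + k + 1) (N + (s + r) + 1) =
    qfactZ q (N + M + (s + r) + 1) * qfactZ q s * qfactZ q r * qfactZ q N *
      qRacahSum q K' (M + r + k) (M + (s + r)) (N + M + (s + r) + 1) r M
        (N + M + (s + r) + 1) (M + (s + r) + k + 1) := by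
  rw [qRacahSum_rotate, qRacahSum_cancel hq hq1 _ _ _ _ _ _ _ (by omega),
    q_saalschutz hq hq1 _ _ _ _ _ _ (by ring) (by omega) (by omega) hK,
    qRacahSum_swap, qRacahSum_cancel hq hq1 _ _ _ _ _ _ _ (by omega),
    q_saalschutz hq hq1 _ _ _ _ _ _ (by ring) (by omega) (by omega) hK']
  have p1 := qfactZ_mul_prod_add q M hM k
  have p2 := qfactZ_mul_prod_add q (N - k) (by omega) k
  have p3 := qfactZ_mul_prod_neg q k (by omega) r
  have p4 := qfactZ_mul_prod_add q s hs r
  rw [qfactInv_of_nonneg q (n := (k : ℤ)) (by omega),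
    qfactInv_of_nonneg q (n := (r : ℤ)) (by omega),
    qfactInv_of_nonneg q hM, qfactInv_of_nonneg q (n := M + (s + r) + k + 1) (by omega),
    qfactInv_of_nonneg q (n := N + (s + r) + 1) (by omega),
    show s + r + k - (k : ℤ) = s + r by ring,
    show s + r + k + M + N + 1 - (k : ℤ) = N + M + (s + r) + 1 by ring,
    show M + r + k - (r : ℤ) = M + k by ring, show M + (s + r) - (r : ℤ) = M + s by ring,
    show M + (s + r) + k + 1 - (s + r + k) = M + 1 by ring,
    show N + (s + r) + 1 - (s + r + k) = N - k + 1 by ring,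
    show M - (M + r + k) = -((k : ℤ) + r) by ring,
    show M + (s + r) + k + 1 - (M + r + k) = s + 1 by ring]
  rw [sub_add_cancel] at p2
  have n1 := (qfactZ_pos hq hq1 k).ne'
  have n2 := (qfactZ_pos hq hq1 r).ne'
  have n3 := (qfactZ_pos hq hq1 M).ne'
  have n4 := (qfactZ_pos hq hq1 (M + (s + r) + k + 1)).ne'
  have n5 := (qfactZ_pos hq hq1 (N + (s + r) + 1)).ne'
  have n6 := (qfactZ_pos hq hq1 (N - k)).ne'
  have n7 := (qfactZ_pos hq hq1 s).ne'
  have hk2 : ((-1 : ℝ) ^ k) ^ 2 = 1 := by rw [← pow_mul, mul_comm, pow_mul]; simp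
  have hr2 : ((-1 : ℝ) ^ r) ^ 2 = 1 := by rw [← pow_mul, mul_comm, pow_mul]; simp
  replace p1 := eq_div_of_mul_eq n3 ((mul_comm _ _).trans p1)
  replace p2 := eq_div_of_mul_eq n6 ((mul_comm _ _).trans p2)
  replace p3 := eq_div_of_mul_eq n1 ((mul_comm _ _).trans p3)
  replace p4 := eq_div_of_mul_eq n7 ((mul_comm _ _).trans p4)
  rw [p1, p2, p3, p4, add_comm (r : ℤ) k]
  field_simp
  rw [hk2, hr2]
  ring

/-- Vanishing of the `q`-Racah sum just outside the triangle inequalities. -/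
lemma qRacahSum_eq_zero {q : ℝ} (hq : 0 < q) (hq1 : q ≠ 1) (K : ℕ) (t₁ t₂ t₃ b₁ b₂ b₃ : ℤ)
    (hb : 0 ≤ b₁) (hK : b₁ < K) (h : t₁ + t₃ + 1 = b₁ + b₂ + b₃) (h1 : b₁ ≤ t₁) (h2 : b₁ ≤ t₂)
    (h3 : b₁ ≤ t₃) (h4 : b₂ ≤ t₁) (h5 : t₁ < b₁ + b₂) :
    qRacahSum q K t₁ t₂ t₃ b₁ b₂ b₃ t₂ = 0 := by
  lift b₁ to ℕ using hb
  rw [qRacahSum_cancel hq hq1 _ _ _ _ _ _ _ h2,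
    q_saalschutz hq hq1 _ _ _ _ _ _ h h1 h3 (by omega)]
  have : ∏ i ∈ Finset.range b₁, qnum q (b₂ - t₁ + i) = 0 := by
    refine Finset.prod_eq_zero (i := (t₁ - b₂).toNat) (by simp; omega) ?_
    rw [Int.toNat_of_nonneg (by omega), sub_add_sub_cancel, sub_self, qnum_zero]
  rw [this]
  ring

/-- The symmetry of the `q`-Racah sums, with the square roots cleared. -/
lemma qRacahSum_symm {q : ℝ} (hq : 0 < q) (hq1 : q ≠ 1) (p : ℕ) :
    ∀ (k : ℕ) (M N l s : ℤ) (K K' : ℕ), 0 ≤ M → k ≤ N → p ≤ N → 0 ≤ s → s ≤ p + l →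
    s ≤ l + k → 0 ≤ l → k < K → p - s + l < K' →
    (-1 : ℝ) ^ k * (qfactZ q (N + l + 1) * qfactZ q (l + k - s) * qfactZ q (M + s) *
        qfactZ q (N - k)) *
      qRacahSum q K (l + k) (l + k + p - s) (l + k + M + N + 1) (l + k - s) k
        (M + p + l + k + 1) (N + l + 1) =
    (-1 : ℝ) ^ p * (qfactZ q (N + M + l + 1) * qfactZ q s * qfactZ q (p - s + l) *
        qfactZ q (N - p)) *
      qRacahSum q K' (M + p - s + l + k) (M + p + l) (M + p + l + N + 1) (p - s + l) (M + p)
        (N + M + l + 1) (M + p + l + k + 1) := by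
  induction p with
  | zero =>
    intro k M N l s K K' hM hkN _ hs hpls hlks hl hK hK'
    obtain ⟨r, rfl⟩ : ∃ r : ℕ, l = s + r := ⟨(l - s).toNat, by omega⟩
    have := qRacahSum_symm_zero hq hq1 M N s k r K K' hM hkN hs hK (by omega)
    rw [pow_zero, one_mul]
    convert this using 2 <;> congr 1 <;> push_cast <;> ring_nf
  | succ p ih =>
    intro k M N l s K K' hM hkN hpN hs hpls hlks hl hK hK'
    push_cast at *
    have relL := qRacahSum_contiguous hq hq1 K (l + k) (l + k + p - s) (l + k + M + N + 1)
      (l + k - s) k (M + (p + 1) + l + k + 1) (N + l + 1) (by omega)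
    have relR := qRacahSum_contiguous_shift hq hq1 K' (M + (p + 1) - s + l + k) (M + (p + 1) + l)
      (M + (p + 1) + l + N + 1) (p + 1 - s + l) (M + (p + 1)) (N + M + l + 1)
      (M + (p + 1) + l + k + 1) (by omega) (by omega)
    have c1 : (-1 : ℝ) ^ k * (qfactZ q (N + l + 1) * qfactZ q (l + k - s) * qfactZ q (M + s + 1) *
          qfactZ q (N - k)) *
        qRacahSum q K (l + k) (l + k + p - s) (l + k + M + N + 1) (l + k - s) (k - 1)
          (M + (p + 1) + l + k + 1) (N + l + 1) =
        (-1 : ℝ) ^ (p + 1) * (qfactZ q (N + M + l + 2) * qfactZ q s * qfactZ q (p + 1 - s + l) *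
          qfactZ q (N - (p + 1))) *
        qRacahSum q K' (M + (p + 1) - s + l + k) (M + (p + 1) + l + 1) (M + (p + 1) + l + N + 1)
          (p + 1 - s + l) (M + (p + 1)) (N + M + l + 1 + 1) (M + (p + 1) + l + k + 1) := by
      cases k with
      | zero =>
        have z1 : qRacahSum q K (l + (0 : ℕ)) (l + (0 : ℕ) + p - s) (l + (0 : ℕ) + M + N + 1)
            (l + (0 : ℕ) - s) ((0 : ℕ) - 1) (M + (p + 1) + l + (0 : ℕ) + 1) (N + l + 1) = 0 := by
          refine Finset.sum_eq_zero fun n _ => ?_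
          rw [qfactInv_of_neg q (n := ((0 : ℕ) : ℤ) - 1 - n) (by omega)]
          ring
        have z2 := qRacahSum_eq_zero hq hq1 K' (M + (p + 1) - s + l + (0 : ℕ))
          (M + (p + 1) + l + 1) (M + (p + 1) + l + N + 1) (p + 1 - s + l) (M + (p + 1))
          (N + M + l + 1 + 1) (by omega) (by omega) (by push_cast; ring) (by omega) (by omega)
          (by omega) (by omega) (by omega)
        rw [z1, show M + ((p : ℤ) + 1) + l + (0 : ℕ) + 1 = M + (p + 1) + l + 1 by simp, z2]
        simp
      | succ k =>
        have := ih k (M + 1) (N - 1) (l + 1) s K K' (by omega) (by omega) (by omega) hs (by omega)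
          (by omega) (by omega) (by omega) (by omega)
        push_cast at *
        have e1 : qRacahSum q K (l + (k + 1)) (l + (k + 1) + p - s) (l + (k + 1) + M + N + 1)
            (l + (k + 1) - s) (k + 1 - 1) (M + (p + 1) + l + (k + 1) + 1) (N + l + 1) =
            qRacahSum q K (l + 1 + k) (l + 1 + k + p - s) (l + 1 + k + (M + 1) + (N - 1) + 1)
            (l + 1 + k - s) k (M + 1 + p + (l + 1) + k + 1) (N - 1 + (l + 1) + 1) := by
          congr 1 <;> ring
        have e2 : qRacahSum q K' (M + (p + 1) - s + l + (k + 1)) (M + (p + 1) + l + 1)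
            (M + (p + 1) + l + N + 1) (p + 1 - s + l) (M + (p + 1)) (N + M + l + 1 + 1)
            (M + (p + 1) + l + (k + 1) + 1) =
            qRacahSum q K' (M + 1 + p - s + (l + 1) + k) (M + 1 + p + (l + 1))
            (M + 1 + p + (l + 1) + (N - 1) + 1) (p - s + (l + 1)) (M + 1 + p)
            (N - 1 + (M + 1) + (l + 1) + 1) (M + 1 + p + (l + 1) + k + 1) := by
          congr 1 <;> ring
        rw [e1, e2, pow_succ, pow_succ, show N + l + 1 = N - 1 + (l + 1) + 1 by ring,
          show l + ((k : ℤ) + 1) - s = l + 1 + k - s by ring, show M + s + 1 = M + 1 + s by ring,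
          show N - ((k : ℤ) + 1) = N - 1 - k by ring,
          show N + M + l + 2 = N - 1 + (M + 1) + (l + 1) + 1 by ring,
          show (p : ℤ) + 1 - s + l = p - s + (l + 1) by ring,
          show N - ((p : ℤ) + 1) = N - 1 - p by ring]
        linear_combination -this
    have c2 : qnum q (p + 1 - s + l) * ((-1 : ℝ) ^ k * (qfactZ q (N + l + 1) *
          qfactZ q (l + k - s) * qfactZ q (M + s) * qfactZ q (N - k)) *
        qRacahSum q K (l + k) (l + k + p - s) (l + k + M + N + 1) (l + k - s) k
          (M + (p + 1) + l + k + 1 - 1) (N + l + 1)) =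
        -((-1 : ℝ) ^ (p + 1)) * (qfactZ q (N + M + l + 1) * qfactZ q s * qfactZ q (p + 1 - s + l) *
          (qnum q (N - p) * qfactZ q (N - (p + 1)))) *
        qRacahSum q K' (M + (p + 1) - s + l + k - 1) (M + (p + 1) + l - 1)
          (M + (p + 1) + l + N + 1 - 1) (p + 1 - s + l - 1) (M + (p + 1) - 1) (N + M + l + 1)
          (M + (p + 1) + l + k + 1 - 1) := by
      rcases lt_or_ge ((p : ℤ) + l) s with hlt | hge
      · have z : qRacahSum q K' (M + (p + 1) - s + l + k - 1) (M + (p + 1) + l - 1)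
            (M + (p + 1) + l + N + 1 - 1) (p + 1 - s + l - 1) (M + (p + 1) - 1) (N + M + l + 1)
            (M + (p + 1) + l + k + 1 - 1) = 0 := by
          refine Finset.sum_eq_zero fun n _ => ?_
          rw [qfactInv_of_neg q (n := (p : ℤ) + 1 - s + l - 1 - n) (by omega)]
          ring
        rw [z, show (p : ℤ) + 1 - s + l = 0 by omega, qnum_zero]
        ring
      · have := ih k M N l s K K' hM hkN (by omega) hs hge hlks hl hK (by omega)
        have f1 := qfactZ_eq_mul q (n := (p : ℤ) + 1 - s + l) (by omega)
        have f2 := qfactZ_eq_mul q (n := N - p) (by omega)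
        rw [show (p : ℤ) + 1 - s + l - 1 = p - s + l by ring] at f1 ⊢
        rw [show N - (p : ℤ) - 1 = N - (p + 1) by ring] at f2
        rw [show M + ((p : ℤ) + 1) + l + k + 1 - 1 = M + p + l + k + 1 by ring,
          show M + ((p : ℤ) + 1) - s + l + k - 1 = M + p - s + l + k by ring,
          show M + ((p : ℤ) + 1) + l - 1 = M + p + l by ring,
          show M + ((p : ℤ) + 1) + l + N + 1 - 1 = M + p + l + N + 1 by ring,
          show M + ((p : ℤ) + 1) - 1 = M + p by ring, this, ← f2, f1, pow_succ]
        ring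
    rw [show l + (k : ℤ) + p - s + 1 = l + k + (p + 1) - s by ring,
      show M + ((p : ℤ) + 1) + l + k + 1 - k = M + (p + 1) + l + 1 by ring,
      show M + ((p : ℤ) + 1) + l + k + 1 - (l + k + (p + 1) - s) = M + s + 1 by ring,
      show l + (k : ℤ) + (p + 1) - s - k = p + 1 - s + l by ring] at relL
    rw [show N + M + l + 1 - (M + (p + 1) + l) = N - p by ring,
      show N + M + l + 1 + 1 = N + M + l + 2 by ring] at relR
    rw [show N + M + l + 1 + 1 = N + M + l + 2 by ring] at c1
    have g1 := qfactZ_eq_mul q (n := M + s + 1) (by omega)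
    have g2 := qfactZ_eq_mul q (n := N + M + l + 2) (by omega)
    rw [add_sub_cancel_right] at g1
    rw [show N + M + l + 2 - 1 = N + M + l + 1 by ring] at g2
    have hne := (qnum_pos hq hq1 (n := M + (p + 1) + l + 1) (by omega)).ne'
    rw [g1, g2] at c1
    refine mul_left_cancel₀ hne ?_
    linear_combination ((-1 : ℝ) ^ k * (qfactZ q (N + l + 1) * qfactZ q (l + k - s) *
      qfactZ q (M + s) * qfactZ q (N - k))) * relL + c1 + c2 -
      ((-1 : ℝ) ^ (p + 1) * (qfactZ q (N + M + l + 1) * qfactZ q s * qfactZ q (p + 1 - s + l) *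
        qfactZ q (N - (p + 1)))) * relR

lemma qfactQ_eq {q : ℝ} {x : ℚ} {m : ℤ} (h : x = m) : qfactQ q x = qfactZ q m := by
  rw [h, qfactQ, Int.floor_intCast, qfactZ]

lemma qnumQ_eq {q : ℝ} {x : ℚ} {m : ℤ} (h : x = m) : qnumQ q x = qnum q m := by
  rw [h, qnumQ, Int.floor_intCast]

/-- The sum in `URacah`, for integral arguments, is a `qRacahSum`. -/
lemma sum_eq_qRacahSum {q : ℝ} {b x₂ x₃ y₁ y₂ y₃ y₄ : ℚ} {t₁ t₂ t₃ b₁ b₂ b₃ b₄ : ℤ}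
    (ht₁ : 2 * b = t₁) (ht₂ : x₂ = t₂) (ht₃ : x₃ = t₃) (hb₁ : y₁ = b₁) (hb₂ : y₂ = b₂)
    (hb₃ : y₃ = b₃) (hb₄ : y₄ = b₄) (h : ∀ n, n ≤ b₁ → n ≤ b₂ → n ≤ t₁ ∧ n ≤ t₂ ∧ n ≤ t₃) :
    (∑ n ∈ Finset.range ((⌊2 * b⌋).toNat + 1),
      if 0 ≤ 2 * b - n ∧ 0 ≤ x₂ - n ∧ 0 ≤ x₃ - n ∧ 0 ≤ y₁ - n ∧ 0 ≤ y₂ - n ∧ 0 ≤ y₃ - n ∧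
          0 ≤ y₄ - n then
        (-1 : ℝ) ^ n * qfactQ q (2 * b - n) * qfactQ q (x₂ - n) * qfactQ q (x₃ - n) /
          (qfact q n * qfactQ q (y₁ - n) * qfactQ q (y₂ - n) * qfactQ q (y₃ - n) *
            qfactQ q (y₄ - n))
      else 0) = qRacahSum q (t₁.toNat + 1) t₁ t₂ t₃ b₁ b₂ b₃ b₄ := by
  rw [ht₁, ht₂, ht₃, hb₁, hb₂, hb₃, hb₄, Int.floor_intCast, qRacahSum]
  refine Finset.sum_congr rfl fun n _ => ?_
  have e : ∀ m : ℤ, (m : ℚ) - n = ((m - n : ℤ) : ℚ) := fun m => by push_cast; rfl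
  have en : qfact q n = qfactZ q n := by simp [qfactZ]
  simp only [e, Int.cast_nonneg_iff, qfactQ_eq rfl, en]
  split_ifs with hc
  · obtain ⟨-, -, -, h1, h2, h3, h4⟩ := hc
    rw [qfactInv_of_nonneg q (Int.natCast_nonneg n), qfactInv_of_nonneg q h1,
      qfactInv_of_nonneg q h2, qfactInv_of_nonneg q h3, qfactInv_of_nonneg q h4]
    simp only [div_eq_mul_inv, mul_inv, mul_assoc]
  · by_cases h1 : b₁ - (n : ℤ) < 0
    · rw [qfactInv_of_neg q h1]; ring
    by_cases h2 : b₂ - (n : ℤ) < 0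
    · rw [qfactInv_of_neg q h2]; ring
    by_cases h3 : b₃ - (n : ℤ) < 0
    · rw [qfactInv_of_neg q h3]; ring
    by_cases h4 : b₄ - (n : ℤ) < 0
    · rw [qfactInv_of_neg q h4]; ring
    have := h n (by omega) (by omega)
    exact absurd ⟨by omega, by omega, by omega, by omega, by omega, by omega, by omega⟩ hc

/-- Symmetry between two explicit q-Racah coefficients of su_q(2):
(−1)^s · sqrt([2U+1][2T+1]/([2j2+1][2j+1])) · U_q(T j3 j1 U; j2 j)
= (−1)^k · U_q(j1 j2 j j3; U T). -/
theorem racah_symmetry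
    (q : ℝ) (hq : 0 < q) (hq1 : q ≠ 1)
    (f1 f2 f3 : ℤ) (k l s p : ℕ)
    (h23 : 2 ≤ f2 - f3) (hk : (k : ℤ) ≤ f1 - f2) (hp : (p : ℤ) ≤ f1 - f2)
    (hpls : (s : ℤ) ≤ (p : ℤ) + (l : ℤ)) (hlks : (s : ℤ) ≤ (l : ℤ) + (k : ℤ))
    (hkps : 0 ≤ f1 - f2 - (k : ℤ) - (p : ℤ) + (s : ℤ))
    (T j1 j2 j3 U j : ℚ)
    (hT : 2 * T = (f2 : ℚ) - (f3 : ℚ) + (p : ℚ) + (s : ℚ) - 2)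
    (hj1 : 2 * j1 = (f1 : ℚ) - (f3 : ℚ) - (p : ℚ) + (s : ℚ) - 2)
    (hj2 : 2 * j2 = (f2 : ℚ) - (f3 : ℚ) + (p : ℚ) - (s : ℚ) + (l : ℚ) + (k : ℚ) - 2)
    (hj3 : 2 * j3 = (l : ℚ) + (k : ℚ))
    (hU : 2 * U = (f1 : ℚ) - (f2 : ℚ) - (k : ℚ) + (l : ℚ))
    (hj : 2 * j = (f1 : ℚ) - (f2 : ℚ)) :
    (-1 : ℝ) ^ s *
        Real.sqrt (qnumQ q (2 * U + 1) * qnumQ q (2 * T + 1) /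
          (qnumQ q (2 * j2 + 1) * qnumQ q (2 * j + 1))) *
        URacah q T j3 j1 U j2 j =
      (-1 : ℝ) ^ k * URacah q j1 j2 j j3 U T := by
  obtain ⟨N, hN⟩ : ∃ N : ℤ, f1 = f2 + N := ⟨f1 - f2, by ring⟩
  obtain ⟨M, hM⟩ : ∃ M : ℤ, f2 = f3 + M + 2 := ⟨f2 - f3 - 2, by ring⟩
  have hNQ : (f1 : ℚ) = f2 + N := by rw [hN]; push_cast; ring
  have hMQ : (f2 : ℚ) = f3 + M + 2 := by rw [hM]; push_cast; ring
  have hM0 : 0 ≤ M := by omega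
  have hNk : (k : ℤ) ≤ N := by omega
  have hNp : (p : ℤ) ≤ N := by omega
  have hNkps : 0 ≤ N - k - p + s := by omega
  have key := qRacahSum_symm hq hq1 p k M N l s (((l : ℤ) + k).toNat + 1)
    ((M + p - s + l + k).toNat + 1) hM0 hNk hNp (by omega) hpls hlks (by omega) (by omega)
    (by omega)
  have cU : 2 * U + 1 = ((N - k + l + 1 : ℤ) : ℚ) := by push_cast; linarith
  have cT : 2 * T + 1 = ((M + p + s + 1 : ℤ) : ℚ) := by push_cast; linarith
  have cj2 : 2 * j2 + 1 = ((M + p - s + l + k + 1 : ℤ) : ℚ) := by push_cast; linarith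
  have cj : 2 * j + 1 = ((N + 1 : ℤ) : ℚ) := by push_cast; linarith
  have sumL := sum_eq_qRacahSum (q := q) (b := j3) (x₂ := j3 + j2 - j1 + j)
    (x₃ := j3 + j2 + j1 + j + 1) (y₁ := -T + j3 + j2) (y₂ := j3 - U + j) (y₃ := T + j3 + j2 + 1)
    (y₄ := j3 + U + j + 1) (t₁ := l + k) (t₂ := l + k + p - s) (t₃ := l + k + M + N + 1)
    (b₁ := l + k - s) (b₂ := k) (b₃ := M + p + l + k + 1) (b₄ := N + l + 1)
    (by push_cast; linarith) (by push_cast; linarith) (by push_cast; linarith)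
    (by push_cast; linarith) (by push_cast; linarith) (by push_cast; linarith)
    (by push_cast; linarith) (by intro n _ _; omega)
  have sumR := sum_eq_qRacahSum (q := q) (b := j2) (x₂ := j2 + U - j + T)
    (x₃ := j2 + U + j + T + 1) (y₁ := -j1 + j2 + U) (y₂ := j2 - j3 + T) (y₃ := j1 + j2 + U + 1)
    (y₄ := j2 + j3 + T + 1) (t₁ := M + p - s + l + k) (t₂ := M + p + l) (t₃ := M + p + l + N + 1)
    (b₁ := p - s + l) (b₂ := M + p) (b₃ := N + M + l + 1) (b₄ := M + p + l + k + 1)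
    (by push_cast; linarith) (by push_cast; linarith) (by push_cast; linarith)
    (by push_cast; linarith) (by push_cast; linarith) (by push_cast; linarith)
    (by push_cast; linarith) (by intro n _ _; omega)
  have sgL : ⌊T + U - j2 - j⌋ = (s : ℤ) - k := by
    rw [show T + U - j2 - j = (((s : ℤ) - k : ℤ) : ℚ) by push_cast; linarith, Int.floor_intCast]
  have sgR : ⌊j1 + j3 - U - T⌋ = (k : ℤ) - p := by
    rw [show j1 + j3 - U - T = (((k : ℤ) - p : ℤ) : ℚ) by push_cast; linarith, Int.floor_intCast]
  rw [URacah, URacah, sumL, sumR, sgL, sgR, qnumQ_eq cU, qnumQ_eq cT, qnumQ_eq cj2, qnumQ_eq cj,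
    qfactQ_eq (show T + j3 + j2 + 1 = ((M + p + l + k + 1 : ℤ) : ℚ) by push_cast; linarith),
    qfactQ_eq (show j3 + U + j + 1 = ((N + l + 1 : ℤ) : ℚ) by push_cast; linarith),
    qfactQ_eq (show T - j3 + j2 = ((M + p : ℤ) : ℚ) by push_cast; linarith),
    qfactQ_eq (show -T + j3 + j2 = ((l + k - s : ℤ) : ℚ) by push_cast; linarith),
    qfactQ_eq (show T + j1 - j = ((M + s : ℤ) : ℚ) by push_cast; linarith),
    qfactQ_eq (show j3 - U + j = ((k : ℤ) : ℚ) by push_cast; linarith),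
    qfactQ_eq (show -j3 + U + j = ((N - k : ℤ) : ℚ) by push_cast; linarith),
    qfactQ_eq (show -j2 + U + j1 = ((N - k - p + s : ℤ) : ℚ) by push_cast; linarith),
    qfactQ_eq (show T + j1 + j + 1 = ((N + M + s + 1 : ℤ) : ℚ) by push_cast; linarith),
    qfactQ_eq (show j2 + U + j1 + 1 = ((N + M + l + 1 : ℤ) : ℚ) by push_cast; linarith),
    qfactQ_eq (show T + j3 - j2 = ((s : ℤ) : ℚ) by push_cast; linarith),
    qfactQ_eq (show T - j1 + j = ((p : ℤ) : ℚ) by push_cast; linarith),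
    qfactQ_eq (show j3 + U - j = ((l : ℤ) : ℚ) by push_cast; linarith),
    qfactQ_eq (show j2 + U - j1 = ((p - s + l : ℤ) : ℚ) by push_cast; linarith),
    qfactQ_eq (show j2 - U + j1 = ((M + k : ℤ) : ℚ) by push_cast; linarith),
    qfactQ_eq (show -T + j1 + j = ((N - p : ℤ) : ℚ) by push_cast; linarith),
    qfactQ_eq (show j1 + j2 + U + 1 = ((N + M + l + 1 : ℤ) : ℚ) by push_cast; linarith),
    qfactQ_eq (show j2 + j3 + T + 1 = ((M + p + l + k + 1 : ℤ) : ℚ) by push_cast; linarith),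
    qfactQ_eq (show j1 - j2 + U = ((N - k - p + s : ℤ) : ℚ) by push_cast; linarith),
    qfactQ_eq (show -j1 + j2 + U = ((p - s + l : ℤ) : ℚ) by push_cast; linarith),
    qfactQ_eq (show j1 + j - T = ((N - p : ℤ) : ℚ) by push_cast; linarith),
    qfactQ_eq (show j2 - j3 + T = ((M + p : ℤ) : ℚ) by push_cast; linarith),
    qfactQ_eq (show -j2 + j3 + T = ((s : ℤ) : ℚ) by push_cast; linarith),
    qfactQ_eq (show -U + j3 + j = ((k : ℤ) : ℚ) by push_cast; linarith),
    qfactQ_eq (show j1 + j + T + 1 = ((N + M + s + 1 : ℤ) : ℚ) by push_cast; linarith),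
    qfactQ_eq (show U + j3 + j + 1 = ((N + l + 1 : ℤ) : ℚ) by push_cast; linarith),
    qfactQ_eq (show j1 + j2 - U = ((M + k : ℤ) : ℚ) by push_cast; linarith),
    qfactQ_eq (show j1 - j + T = ((M + s : ℤ) : ℚ) by push_cast; linarith),
    qfactQ_eq (show j2 + j3 - T = ((l + k - s : ℤ) : ℚ) by push_cast; linarith),
    qfactQ_eq (show U + j3 - j = ((l : ℤ) : ℚ) by push_cast; linarith),
    qfactQ_eq (show U - j3 + j = ((N - k : ℤ) : ℚ) by push_cast; linarith),
    qfactQ_eq (show -j1 + j + T = ((p : ℤ) : ℚ) by push_cast; linarith)]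
  have hpos := qfactZ_pos hq hq1
  have hu1 : 0 < qnum q (N - k + l + 1) := qnum_pos hq hq1 (by omega)
  have hu2 : 0 < qnum q (M + p + s + 1) := qnum_pos hq hq1 (by omega)
  have hu3 : 0 < qnum q (M + p - s + l + k + 1) := qnum_pos hq hq1 (by omega)
  have hu4 : 0 < qnum q (N + 1) := qnum_pos hq hq1 (by omega)
  have hx1 := hpos (M + p + l + k + 1)
  have hx2 := hpos (N + l + 1)
  have hx3 := hpos (M + p)
  have hx4 := hpos (l + k - s)
  have hx5 := hpos (M + s)
  have hx6 := hpos k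
  have hx7 := hpos (N - k)
  have hx8 := hpos (N - k - p + s)
  have hx9 := hpos (N + M + s + 1)
  have hx10 := hpos (N + M + l + 1)
  have hx11 := hpos s
  have hx12 := hpos p
  have hx13 := hpos l
  have hx14 := hpos (p - s + l)
  have hx15 := hpos (M + k)
  have hx16 := hpos (N - p)
  have sign (a b : ℕ) : (-1 : ℝ) ^ a * (-1 : ℝ) ^ ((a : ℤ) - b) = (-1) ^ b := by
    rw [zpow_sub₀ (by norm_num), zpow_natCast, zpow_natCast, ← mul_div_assoc, ← mul_pow,
      neg_one_mul, neg_neg, one_pow, one_div, ← inv_pow, inv_neg_one]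
  generalize qRacahSum q (((l : ℤ) + k).toNat + 1) _ _ _ _ _ _ _ = SL at key ⊢
  generalize qRacahSum q ((M + p - s + l + k).toNat + 1) _ _ _ _ _ _ _ = SR at key ⊢
  generalize qnum q (N - k + l + 1) = u1 at *
  generalize qnum q (M + p + s + 1) = u2 at *
  generalize qnum q (M + p - s + l + k + 1) = u3 at *
  generalize qnum q (N + 1) = u4 at *
  generalize qfactZ q (M + p + l + k + 1) = x1 at *
  generalize qfactZ q (N + l + 1) = x2 at *
  generalize qfactZ q (M + p) = x3 at *
  generalize qfactZ q (l + k - s) = x4 at *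
  generalize qfactZ q (M + s) = x5 at *
  generalize qfactZ q k = x6 at *
  generalize qfactZ q (N - k) = x7 at *
  generalize qfactZ q (N - k - p + s) = x8 at *
  generalize qfactZ q (N + M + s + 1) = x9 at *
  generalize qfactZ q (N + M + l + 1) = x10 at *
  generalize qfactZ q s = x11 at *
  generalize qfactZ q p = x12 at *
  generalize qfactZ q l = x13 at *
  generalize qfactZ q (p - s + l) = x14 at *
  generalize qfactZ q (M + k) = x15 at *
  generalize qfactZ q (N - p) = x16 at *
  have root : √(u1 * u2 / (u3 * u4)) * √(u3 * u4 * x1 * x2 * x3 * x4 * x5 * x6 * x7 * x8 /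
        (x9 * x10 * x11 * x12 * x13 * x14 * x15 * x16)) =
      (x2 * x4 * x5 * x7) / (x10 * x11 * x14 * x16) *
        √(u1 * u2 * x10 * x1 * x8 * x14 * x16 * x3 * x11 * x6 /
          (x9 * x2 * x15 * x5 * x4 * x13 * x7 * x12)) := by
    rw [← Real.sqrt_mul (by positivity), ← Real.sqrt_sq (show
      0 ≤ (x2 * x4 * x5 * x7) / (x10 * x11 * x14 * x16) by positivity),
      ← Real.sqrt_mul (by positivity)]
    congr 1
    field_simp
  have key' : (-1 : ℝ) ^ k * ((x2 * x4 * x5 * x7) / (x10 * x11 * x14 * x16)) * SL =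
      (-1) ^ p * SR := by
    field_simp
    linear_combination key
  generalize √(u1 * u2 / (u3 * u4)) = r at root ⊢
  generalize √(u3 * u4 * x1 * x2 * x3 * x4 * x5 * x6 * x7 * x8 /
        (x9 * x10 * x11 * x12 * x13 * x14 * x15 * x16)) = rL at root ⊢
  generalize √(u1 * u2 * x10 * x1 * x8 * x14 * x16 * x3 * x11 * x6 /
        (x9 * x2 * x15 * x5 * x4 * x13 * x7 * x12)) = rR at root ⊢
  linear_combination (r * rL * SL) * sign s k + ((-1) ^ k * SL) * root + rR * key' -
    (rR * SR) * sign k p
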